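/- Let h ∈ Matrix (Fin 2) (Fin 2) ℂ with det h = 1 be Hermitian positive definite. Then δ(h) = 2, and δ attains a local maximum on SL(2,ℂ) at h: there exists ε > 0 such that for every z ∈ Matrix (Fin 2) (Fin 2) ℂ with det z = 1 and ‖z − h‖ < ε one has δ(z) ≤ 2. -/

import Mathlib

open Matrix
open scoped ComplexOrder

attribute [local instance] Matrix.normedAddCommGroup

/-- The `SL(2,ℂ)`-invariant function `δ(z) = Re(det(z + zᴴ)) − 2`. -/
noncomputable def deltaFun (z : Matrix (Fin 2) (Fin 2) ℂ) : ℝ :=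
  ((z + zᴴ).det).re - 2

theorem real_aux (a1 a2 b1 b2 c1 c2 d1 d2 : ℝ)
    (hr : a1 * d1 - a2 * d2 - (b1 * c1 - b2 * c2) = 1)
    (hi : a1 * d2 + a2 * d1 - (b1 * c2 + b2 * c1) = 0) :
    4 * (a1 * d1) - ((b1 + c1) ^ 2 + (b2 - c2) ^ 2) ≤ 4 := by
  by_contra! hP
  have hQ : (b1 - c1) ^ 2 + (b2 + c2) ^ 2 < 4 * (a2 * d2) := by nlinarith
  have hP' : (b1 + c1) ^ 2 + (b2 - c2) ^ 2 < 4 * (a1 * d1) := by linarith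
  have h1 := mul_lt_mul'' hP' hQ (by positivity) (by positivity)
  have h2 : (2 * (b1 * c2 + b2 * c1)) ^ 2 ≤
      ((b1 + c1) ^ 2 + (b2 - c2) ^ 2) * ((b1 - c1) ^ 2 + (b2 + c2) ^ 2) := by
    have := sq_nonneg ((b1 + c1) * (b1 - c1) + (b2 - c2) * (b2 + c2))
    nlinarith
  have h3 : b1 * c2 + b2 * c1 = a1 * d2 + a2 * d1 := by linarith
  rw [h3] at h2
  nlinarith [sq_nonneg (a1 * d2 - a2 * d1)]

/-- For a Hermitian positive definite `h` with `det h = 1`, one has `δ(h) = 2` and `δ`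
attains a local maximum on `SL(2,ℂ)` at `h`. -/
theorem delta_local_max_at_posdef (h : Matrix (Fin 2) (Fin 2) ℂ)
    (hdet : h.det = 1) (hpos : h.PosDef) :
    deltaFun h = 2 ∧
    ∃ ε > (0 : ℝ), ∀ z : Matrix (Fin 2) (Fin 2) ℂ,
      z.det = 1 → ‖z - h‖ < ε → deltaFun z ≤ 2 := by
  refine ⟨?_, 1, one_pos, fun z hz _ => ?_⟩
  · have hh : hᴴ = h := hpos.isHermitian
    have : (h + hᴴ).det = 4 := by
      rw [hh, ← two_smul ℂ h, Matrix.det_smul, hdet]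
      norm_num
    rw [deltaFun, this]
    norm_num
  · rw [Matrix.det_fin_two] at hz
    have hr := congrArg Complex.re hz
    have hi := congrArg Complex.im hz
    simp only [Complex.sub_re, Complex.sub_im, Complex.mul_re, Complex.mul_im,
      Complex.one_re, Complex.one_im] at hr hi
    have := real_aux (z 0 0).re (z 0 0).im (z 0 1).re (z 0 1).im (z 1 0).re (z 1 0).im
      (z 1 1).re (z 1 1).im (by linarith) (by linarith)
    rw [deltaFun, Matrix.det_fin_two]
    simp only [Matrix.add_apply, Matrix.conjTranspose_apply, Complex.sub_re, Complex.mul_re,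
      Complex.add_re, Complex.add_im, Complex.star_def, Complex.conj_re, Complex.conj_im]
    nlinarith
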